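/- Fix real constants A and B, and define μ : ℝ → ℝ → ℝ by μ(t, x) = (t − A)·(Real.tanh(x − B)² − 1). Then μ satisfies the partial differential equation μ·μ_xx − (μ_x)² − 2·μ²·μ_t = 0 at every point (t, x), where μ_x and μ_xx denote the first and second derivatives of x ↦ μ(t, x) and μ_t denotes the derivative of t ↦ μ(t, x). -/

import Mathlib

noncomputable section

/-- The explicit solution `μ(t, x) = (t − A)·(tanh(x − B)² − 1)` of the 2-dimensional
Ricci flow PDE. -/
def mu (A B t x : ℝ) : ℝ := (t - A) * ((Real.tanh (x - B))^2 - 1)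

theorem Real.hasDerivAt_tanh (x : ℝ) : HasDerivAt Real.tanh (1 - Real.tanh x ^ 2) x := by
  have hc := (Real.cosh_pos x).ne'
  have h := (Real.hasDerivAt_sinh x).div (Real.hasDerivAt_cosh x) hc
  rw [show Real.tanh = Real.sinh / Real.cosh from funext Real.tanh_eq_sinh_div_cosh]
  refine h.congr_deriv ?_
  simp only [Pi.div_apply]
  field_simp

theorem hasDerivAt_tanh_sub (B x : ℝ) :
    HasDerivAt (fun y => Real.tanh (y - B)) (1 - Real.tanh (x - B) ^ 2) x :=
  (Real.hasDerivAt_tanh (x - B)).comp_sub_const x B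

theorem hasDerivAt_mu_space (A B t x : ℝ) :
    HasDerivAt (fun y => mu A B t y)
      (2 * (t - A) * (Real.tanh (x - B) - Real.tanh (x - B) ^ 3)) x := by
  refine ((((hasDerivAt_tanh_sub B x).pow 2).sub_const 1).const_mul (t - A)).congr_deriv ?_
  push_cast
  ring

theorem hasDerivAt_mu_time (A B t x : ℝ) :
    HasDerivAt (fun s => mu A B s x) (Real.tanh (x - B) ^ 2 - 1) t :=
  (((hasDerivAt_id t).sub_const A).mul_const _).congr_deriv (one_mul _)

theorem hasDerivAt_deriv_mu_space (A B t x : ℝ) :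
    HasDerivAt (deriv (fun y => mu A B t y))
      (2 * (t - A) * ((1 - 3 * Real.tanh (x - B) ^ 2) * (1 - Real.tanh (x - B) ^ 2))) x := by
  rw [show deriv (fun y => mu A B t y) = _ from
    funext fun y => (hasDerivAt_mu_space A B t y).deriv]
  have h := hasDerivAt_tanh_sub B x
  refine ((h.sub (h.pow 3)).const_mul (2 * (t - A))).congr_deriv ?_
  push_cast
  ring

/-- `μ(t, x) = (t − A)·(tanh(x − B)² − 1)` satisfies the PDE
`μ·μ_xx − (μ_x)² − 2·μ²·μ_t = 0`. -/
theorem mu_solves_pde (A B t x : ℝ) :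
    mu A B t x * deriv (deriv (fun y => mu A B t y)) x
      - (deriv (fun y => mu A B t y) x)^2
      - 2 * (mu A B t x)^2 * deriv (fun s => mu A B s x) t = 0 := by
  rw [(hasDerivAt_deriv_mu_space A B t x).deriv, (hasDerivAt_mu_space A B t x).deriv,
    (hasDerivAt_mu_time A B t x).deriv, mu]
  ring
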